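/- arXiv:2509.16234 — 3 statements merged into one kernel-verified Lean document; each statement's English description precedes it below -/
import Mathlib

section
/- Let p be a prime, n ≥ 1, f ∈ ℤ[X], and let v ∈ ZMod p^n be a periodic point of F_{p^n} of minimal period k with λ̄(v) = 1 in ZMod p and r_v ≠ 0. Then every lift w ∈ ZMod p^{n+1} of v is a periodic point of F_{p^{n+1}} of minimal period k·p (so the lifted graph of the cycle of v consists of a single cycle of size k·p). -/
/-- The map on `ZMod m` induced by a polynomial `f ∈ ℤ[X]`. -/
noncomputable def polyMap (m : ℕ) (f : Polynomial ℤ) : ZMod m → ZMod m :=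
  fun x => Polynomial.aeval x f

/-- The multiplier `λ(v) = ∏_{i=0}^{k-1} f'(F_m^i(v)) ∈ ZMod m` of a periodic point `v`
of minimal period `k`. -/
noncomputable def multiplier (m : ℕ) (f : Polynomial ℤ) (k : ℕ) (v : ZMod m) : ZMod m :=
  ∏ i ∈ Finset.range k, Polynomial.aeval ((polyMap m f)^[i] v) (Polynomial.derivative f)

/-- `f^{∘k} : ℤ → ℤ`, the `k`-fold iterate of the polynomial map of `f`. -/
noncomputable def polyIter (f : Polynomial ℤ) (k : ℕ) : ℤ → ℤ :=
  (fun x : ℤ => Polynomial.eval x f)^[k]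

theorem polyMap_iterate_intCast (m : ℕ) (f : Polynomial ℤ) (k : ℕ) (x : ℤ) :
    (polyMap m f)^[k] (x : ZMod m) = (polyIter f k x : ℤ) := by
  have h : Function.Semiconj (fun x : ℤ => (x : ZMod m)) (fun x : ℤ => Polynomial.eval x f)
      (polyMap m f) := fun y => by
    simpa [polyMap] using (Polynomial.aeval_algebraMap_apply (ZMod m) y f).symm
  exact ((h.iterate_right k) x).symm

theorem multiplier_intCast (m : ℕ) (f : Polynomial ℤ) (k : ℕ) (x : ℤ) :
    multiplier m f k (x : ZMod m) =
      ((∏ i ∈ Finset.range k, Polynomial.eval (polyIter f i x) (Polynomial.derivative f) : ℤ) :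
        ZMod m) := by
  rw [multiplier, Int.cast_prod]
  refine Finset.prod_congr rfl fun i _ => ?_
  rw [polyMap_iterate_intCast]
  simpa using Polynomial.aeval_algebraMap_apply (ZMod m) (polyIter f i x) (Polynomial.derivative f)

/-- First-order Taylor expansion of an iterate of a polynomial map, modulo `q` with `q ∣ d ^ 2`. -/
theorem polyIter_add_mul_modEq (f : Polynomial ℤ) {d q : ℤ} (hq : q ∣ d ^ 2) (x s : ℤ) (k : ℕ) :
    polyIter f k (x + s * d) ≡ polyIter f k x + s * d *
      ∏ i ∈ Finset.range k, Polynomial.eval (polyIter f i x) (Polynomial.derivative f)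
      [ZMOD q] := by
  induction k with
  | zero => simp [polyIter, Int.ModEq.refl]
  | succ k ih =>
    have step (y : ℤ) : polyIter f (k + 1) y = Polynomial.eval (polyIter f k y) f :=
      Function.iterate_succ_apply' _ _ _
    rw [step, step, Finset.prod_range_succ]
    set M := ∏ i ∈ Finset.range k, Polynomial.eval (polyIter f i x) (Polynomial.derivative f)
    set y := polyIter f k x
    obtain ⟨c, hc⟩ := f.binomExpansion y (s * d * M)
    have h₁ : Polynomial.eval (polyIter f k (x + s * d)) f ≡
        Polynomial.eval (y + s * d * M) f [ZMOD q] :=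
      (Int.modEq_iff_dvd.2 (ih.dvd.trans (Polynomial.sub_dvd_eval_sub _ _ f)))
    refine h₁.trans (Int.ModEq.symm (Int.modEq_iff_dvd.2 ?_))
    rw [hc]
    refine hq.trans ⟨c * (s * M) ^ 2, ?_⟩
    ring

/-- If the `k`-th iterate translates the residue class of `a` by `r * d` modulo `q`, its
`j`-th power translates by `j * (r * d)`. -/
theorem polyIter_mul_modEq (f : Polynomial ℤ) {d q a r : ℤ} {k : ℕ}
    (h : ∀ s : ℤ, polyIter f k (a + s * d) ≡ a + (s + r) * d [ZMOD q]) (s : ℤ) (j : ℕ) :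
    polyIter f (k * j) (a + s * d) ≡ a + (s + j * r) * d [ZMOD q] := by
  induction j with
  | zero => simp [polyIter, Int.ModEq.refl]
  | succ j ih =>
    have e : polyIter f (k * (j + 1)) (a + s * d) =
        polyIter f k (polyIter f (k * j) (a + s * d)) := by
      rw [mul_add, mul_one, add_comm]
      exact Function.iterate_add_apply _ _ _ _
    have hc (i : ℕ) {x y : ℤ} (hxy : x ≡ y [ZMOD q]) : polyIter f i x ≡ polyIter f i y [ZMOD q] := by
      induction i with
      | zero => exact hxy
      | succ i hi =>
        simp only [polyIter, Function.iterate_succ_apply'] at hi ⊢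
        exact Int.modEq_iff_dvd.2 (hi.dvd.trans (Polynomial.sub_dvd_eval_sub _ _ f))
    rw [e]
    have e' : a + (s + j * r + r) * d = a + (s + (j + 1 : ℕ) * r) * d := by
      push_cast
      ring
    exact e' ▸ (hc k ih).trans (h _)

/-- Let `v ∈ ZMod p^n` be a periodic point of `F_{p^n}` of minimal period `k`
with `λ̄(v) = 1` in `ZMod p` and `r_v ≠ 0` (where `r_v ∈ [0, p)` is determined by
`f^{∘k}(a_v) ≡ a_v + r_v·p^n (mod p^{n+1})` for the representative `a_v ∈ [0, p^n)` of `v`).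
Then every lift `w ∈ ZMod p^{n+1}` of `v` is a periodic point of `F_{p^{n+1}}` of minimal
period `k·p`. -/
theorem lift_cycle_multiplier_one_r_ne_zero (p : ℕ) (hp : p.Prime) (n : ℕ) (hn : n ≠ 0)
    (f : Polynomial ℤ) (k : ℕ) (v : ZMod (p ^ n))
    (hv : v ∈ Function.periodicPts (polyMap (p ^ n) f))
    (hk : Function.minimalPeriod (polyMap (p ^ n) f) v = k)
    (hlam : ZMod.castHom (dvd_pow_self p hn) (ZMod p) (multiplier (p ^ n) f k v) = 1)
    (r : ℕ) (hrp : r < p)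
    (hr : polyIter f k (v.val : ℤ) ≡
      (v.val : ℤ) + (r : ℤ) * (p : ℤ) ^ n [ZMOD (p : ℤ) ^ (n + 1)])
    (hr0 : r ≠ 0) :
    ∀ w : ZMod (p ^ (n + 1)),
      ZMod.castHom (pow_dvd_pow p (Nat.le_succ n)) (ZMod (p ^ n)) w = v →
      w ∈ Function.periodicPts (polyMap (p ^ (n + 1)) f) ∧
        Function.minimalPeriod (polyMap (p ^ (n + 1)) f) w = k * p := by
  have hp0 : (p : ℤ) ≠ 0 := by exact_mod_cast hp.ne_zero
  have : NeZero (p ^ n) := ⟨pow_ne_zero _ hp.ne_zero⟩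
  have : NeZero (p ^ (n + 1)) := ⟨pow_ne_zero _ hp.ne_zero⟩
  intro w hw
  set a : ℤ := (v.val : ℤ) with ha
  have hva : v = (a : ZMod (p ^ n)) := by simp [ha]
  obtain ⟨b, rfl⟩ : ∃ b : ℤ, w = (b : ZMod (p ^ (n + 1))) := ⟨w.val, by simp⟩
  have hbv : ((b : ℤ) : ZMod (p ^ n)) = v := by rw [← hw, map_intCast]
  obtain ⟨s, hs⟩ : ∃ s : ℤ, b = a + s * (p : ℤ) ^ n := by
    have h := (ZMod.intCast_eq_intCast_iff_dvd_sub a b (p ^ n)).1 (by rw [hbv, ← hva])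
    obtain ⟨s, hs⟩ := h
    exact ⟨s, by push_cast at hs; linarith⟩
  have hM := hlam
  rw [hva, multiplier_intCast, map_intCast, ← Int.cast_one, ZMod.intCast_eq_intCast_iff] at hM
  have htrans : ∀ s : ℤ, polyIter f k (a + s * (p : ℤ) ^ n) ≡
      a + (s + r) * (p : ℤ) ^ n [ZMOD (p : ℤ) ^ (n + 1)] := by
    intro s
    have hq : (p : ℤ) ^ (n + 1) ∣ ((p : ℤ) ^ n) ^ 2 := by
      rw [← pow_mul]
      exact pow_dvd_pow _ (by omega)
    have e : a + (s + r) * (p : ℤ) ^ n = a + r * (p : ℤ) ^ n + s * (p : ℤ) ^ n := by ring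
    rw [e]
    refine (polyIter_add_mul_modEq f hq a s k).trans (hr.add ?_)
    have h := (hM.mul_left' (c := (p : ℤ) ^ n)).mul_left s
    rw [← pow_succ, mul_one, ← mul_assoc] at h
    exact h
  have hiter (j : ℕ) :
      Function.IsPeriodicPt (polyMap (p ^ (n + 1)) f) (k * j) (b : ZMod (p ^ (n + 1))) ↔ p ∣ j := by
    have hj := polyIter_mul_modEq f htrans s j
    rw [← hs] at hj
    rw [Function.IsPeriodicPt, Function.IsFixedPt, polyMap_iterate_intCast, eq_comm,
      ZMod.intCast_eq_intCast_iff]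
    push_cast
    have e : a + (s + j * r) * (p : ℤ) ^ n - b = (p : ℤ) ^ n * (j * r) := by rw [hs]; ring
    have : b ≡ polyIter f (k * j) b [ZMOD (p : ℤ) ^ (n + 1)] ↔
        b ≡ a + (s + j * r) * (p : ℤ) ^ n [ZMOD (p : ℤ) ^ (n + 1)] :=
      ⟨fun h => h.trans hj, fun h => h.trans hj.symm⟩
    rw [this, Int.modEq_iff_dvd, e, pow_succ, mul_dvd_mul_iff_left (pow_ne_zero n hp0)]
    norm_cast
    rw [hp.dvd_mul]
    exact or_iff_left (Nat.not_dvd_of_pos_of_lt (Nat.pos_of_ne_zero hr0) hrp)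
  have hkpos : 0 < k := hk ▸ Function.minimalPeriod_pos_of_mem_periodicPts hv
  have hper := (hiter p).2 dvd_rfl
  refine ⟨Function.mk_mem_periodicPts (Nat.mul_pos hkpos hp.pos) hper,
    Nat.dvd_antisymm hper.minimalPeriod_dvd ?_⟩
  have hmin := Function.isPeriodicPt_minimalPeriod (polyMap (p ^ (n + 1)) f)
    (b : ZMod (p ^ (n + 1)))
  have hdvd : k ∣ Function.minimalPeriod (polyMap (p ^ (n + 1)) f) (b : ZMod (p ^ (n + 1))) := by
    rw [← hk]
    refine Function.IsPeriodicPt.minimalPeriod_dvd ?_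
    have h := congrArg (ZMod.castHom (pow_dvd_pow p (Nat.le_succ n)) (ZMod (p ^ n))) hmin.eq
    rw [polyMap_iterate_intCast, map_intCast, map_intCast, ← polyMap_iterate_intCast, hbv] at h
    exact h
  obtain ⟨j, hj⟩ := hdvd
  rw [hj] at hmin ⊢
  exact Nat.mul_dvd_mul_left k ((hiter j).1 hmin)
end

section
/- Let p be a prime, n ≥ 1, f ∈ ℤ[X], and let v ∈ ZMod p^n be a periodic point of F_{p^n} of minimal period k whose reduced multiplier λ̄(v) ∈ ZMod p satisfies λ̄(v) ≠ 0 and λ̄(v) ≠ 1. Then there exists exactly one lift w ∈ ZMod p^{n+1} of v that is a periodic point of F_{p^{n+1}} of minimal period k. -/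
lemma map_polyMap {m l : ℕ} (φ : ZMod m →+* ZMod l) (f : Polynomial ℤ) (x : ZMod m) :
    φ (polyMap m f x) = polyMap l f (φ x) := by
  simp only [polyMap, Polynomial.aeval_def, Polynomial.hom_eval₂]
  congr 1
  exact RingHom.ext_int _ _

lemma semiconj_polyMap {m l : ℕ} (φ : ZMod m →+* ZMod l) (f : Polynomial ℤ) :
    Function.Semiconj φ (polyMap m f) (polyMap l f) :=
  map_polyMap φ f

lemma map_multiplier {m l : ℕ} (φ : ZMod m →+* ZMod l) (f : Polynomial ℤ) (k : ℕ) (x : ZMod m) :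
    φ (multiplier m f k x) = multiplier l f k (φ x) := by
  rw [multiplier, map_prod, multiplier]
  refine Finset.prod_congr rfl fun i _ => ?_
  rw [← ((semiconj_polyMap φ f).iterate_right i).eq x]
  exact map_polyMap φ (Polynomial.derivative f) _

/-- First-order Taylor expansion of the iterates of `polyMap m f` along a square-zero increment. -/
lemma iterate_polyMap_add_of_sq_eq_zero {m : ℕ} (f : Polynomial ℤ) (k : ℕ) {x d : ZMod m}
    (hd : d ^ 2 = 0) :
    (polyMap m f)^[k] (x + d) = (polyMap m f)^[k] x + multiplier m f k x * d := by
  induction k with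
  | zero => simp [multiplier]
  | succ k ih =>
    have hsq : (multiplier m f k x * d) ^ 2 = 0 := by rw [mul_pow, hd, mul_zero]
    rw [Function.iterate_succ_apply', ih, Function.iterate_succ_apply', polyMap,
      Polynomial.aeval_add_of_sq_eq_zero _ _ _ hsq, multiplier, multiplier,
      Finset.prod_range_succ]
    change _ = Polynomial.aeval ((polyMap m f)^[k] x) f + _
    ring

lemma ZMod.isUnit_of_castHom_ne_zero {p N : ℕ} (hp : p.Prime) (hN : N ≠ 0) {a : ZMod (p ^ N)}
    (ha : ZMod.castHom (dvd_pow_self p hN) (ZMod p) a ≠ 0) : IsUnit a := by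
  have : NeZero (p ^ N) := ⟨pow_ne_zero _ hp.ne_zero⟩
  obtain ⟨b, rfl⟩ := ZMod.natCast_zmod_surjective a
  rw [map_natCast, Ne, ZMod.natCast_eq_zero_iff] at ha
  exact (ZMod.isUnit_iff_coprime b (p ^ N)).2
    (((Nat.Prime.coprime_iff_not_dvd hp).2 ha).symm.pow_right N)

lemma ZMod.sq_eq_zero_of_castHom_eq_zero {p n : ℕ} (hp : p ≠ 0) (hn : n ≠ 0)
    {d : ZMod (p ^ (n + 1))}
    (hd : ZMod.castHom (pow_dvd_pow p (Nat.le_succ n)) (ZMod (p ^ n)) d = 0) : d ^ 2 = 0 := by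
  have : NeZero (p ^ (n + 1)) := ⟨pow_ne_zero _ hp⟩
  obtain ⟨b, rfl⟩ := ZMod.natCast_zmod_surjective d
  rw [map_natCast, ZMod.natCast_eq_zero_iff] at hd
  rw [← Nat.cast_pow, ZMod.natCast_eq_zero_iff]
  calc p ^ (n + 1) ∣ p ^ (n * 2) := pow_dvd_pow p (by omega)
    _ = (p ^ n) ^ 2 := pow_mul p n 2
    _ ∣ b ^ 2 := pow_dvd_pow_of_dvd hd 2

/-- A lift of a periodic point has the same minimal period if and only if that period is one of
the lift. -/
lemma mem_periodicPts_and_minimalPeriod_eq_iff {α β : Type*} {g : α → α} {h : β → β} {φ : α → β}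
    (hφ : Function.Semiconj φ g h) {x : α} (hx : φ x ∈ Function.periodicPts h) :
    (x ∈ Function.periodicPts g ∧
      Function.minimalPeriod g x = Function.minimalPeriod h (φ x)) ↔
      g^[Function.minimalPeriod h (φ x)] x = x := by
  constructor
  · rintro ⟨-, hmin⟩
    rw [← hmin]
    exact Function.iterate_minimalPeriod
  · intro hper
    have hper : Function.IsPeriodicPt g (Function.minimalPeriod h (φ x)) x := hper
    refine ⟨⟨_, Function.minimalPeriod_pos_of_mem_periodicPts hx, hper⟩,
      Nat.dvd_antisymm hper.minimalPeriod_dvd ?_⟩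
    exact ((Function.isPeriodicPt_minimalPeriod g x).map hφ).minimalPeriod_dvd

/-- Let `v ∈ ZMod p^n` be a periodic point of `F_{p^n}` of minimal period `k`
whose reduced multiplier `λ̄(v) ∈ ZMod p` satisfies `λ̄(v) ≠ 0` and `λ̄(v) ≠ 1`. Then there
exists exactly one lift `w ∈ ZMod p^{n+1}` of `v` that is a periodic point of `F_{p^{n+1}}`
of minimal period `k`. -/
theorem lift_cycle_multiplier_general_unique_small (p : ℕ) (hp : p.Prime) (n : ℕ) (hn : n ≠ 0)
    (f : Polynomial ℤ) (k : ℕ) (v : ZMod (p ^ n))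
    (hv : v ∈ Function.periodicPts (polyMap (p ^ n) f))
    (hk : Function.minimalPeriod (polyMap (p ^ n) f) v = k)
    (hlam0 : ZMod.castHom (dvd_pow_self p hn) (ZMod p) (multiplier (p ^ n) f k v) ≠ 0)
    (hlam1 : ZMod.castHom (dvd_pow_self p hn) (ZMod p) (multiplier (p ^ n) f k v) ≠ 1) :
    ∃! w : ZMod (p ^ (n + 1)),
      ZMod.castHom (pow_dvd_pow p (Nat.le_succ n)) (ZMod (p ^ n)) w = v ∧
        w ∈ Function.periodicPts (polyMap (p ^ (n + 1)) f) ∧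
        Function.minimalPeriod (polyMap (p ^ (n + 1)) f) w = k := by
  subst hk
  set k := Function.minimalPeriod (polyMap (p ^ n) f) v with hkdef
  set π := ZMod.castHom (pow_dvd_pow p (Nat.le_succ n)) (ZMod (p ^ n)) with hπ
  have hlift : ∀ w, π w = v → ((w ∈ Function.periodicPts (polyMap (p ^ (n + 1)) f) ∧
      Function.minimalPeriod (polyMap (p ^ (n + 1)) f) w = k) ↔
      (polyMap (p ^ (n + 1)) f)^[k] w = w) := by
    rintro w rfl
    exact mem_periodicPts_and_minimalPeriod_eq_iff (semiconj_polyMap π f) hv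
  obtain ⟨w₀, hw₀⟩ := ZMod.castHom_surjective (pow_dvd_pow p (Nat.le_succ n)) v
  have hunit : IsUnit (multiplier (p ^ (n + 1)) f k w₀ - 1) := by
    refine ZMod.isUnit_of_castHom_ne_zero hp n.succ_ne_zero ?_
    have hcomp : (ZMod.castHom (dvd_pow_self p hn) (ZMod p)).comp π =
        ZMod.castHom (dvd_pow_self p n.succ_ne_zero) (ZMod p) := RingHom.ext_zmod _ _
    rwa [map_sub, map_one, sub_ne_zero, ← hcomp, RingHom.comp_apply, map_multiplier π, hπ, hw₀]
  obtain ⟨u, hu⟩ := hunit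
  set c := (polyMap (p ^ (n + 1)) f)^[k] w₀ - w₀ with hc
  have hcker : π c = 0 := by
    rw [hc, map_sub, ((semiconj_polyMap π f).iterate_right k).eq w₀, hπ, hw₀, hkdef,
      Function.iterate_minimalPeriod, sub_self]
  have hfix : ∀ d, π d = 0 →
      ((polyMap (p ^ (n + 1)) f)^[k] (w₀ + d) = w₀ + d ↔ d = -(↑u⁻¹ * c)) := by
    intro d hd
    rw [iterate_polyMap_add_of_sq_eq_zero f k
      (ZMod.sq_eq_zero_of_castHom_eq_zero hp.ne_zero hn hd), ← mul_neg, Units.eq_inv_mul_iff_mul_eq,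
      hu, hc]
    constructor <;> intro h <;> linear_combination h
  have hdker : π (-(↑u⁻¹ * c)) = 0 := by rw [map_neg, map_mul, hcker, mul_zero, neg_zero]
  have hw : π (w₀ + -(↑u⁻¹ * c)) = v := by rw [map_add, hdker, add_zero, hπ, hw₀]
  refine ⟨w₀ + -(↑u⁻¹ * c), ⟨hw, (hlift _ hw).2 ((hfix _ hdker).2 rfl)⟩, ?_⟩
  rintro w ⟨hwv, hper⟩
  have hd : π (w - w₀) = 0 := by rw [map_sub, hwv, hπ, hw₀, sub_self]
  have hwper := (hlift w hwv).1 hper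
  rw [← add_sub_cancel w₀ w] at hwper
  rw [← (hfix _ hd).1 hwper, add_sub_cancel]
end

section
/- Let p be a prime, f ∈ ℤ[X], and let v ∈ ZMod p be a periodic point of F_p of minimal period k with λ̄(v) = 0 in ZMod p. Then for every n ≥ 1, the periodic points w of F_{p^n} with π(w) lying on the cycle of v (π the projection ZMod p^n → ZMod p) form a single cycle of size k. -/
theorem dvd_aeval_sub_of_dvd_sub {R : Type*} [CommRing R] (f : Polynomial ℤ) {a b d : R}
    (h : d ∣ a - b) : d ∣ Polynomial.aeval a f - Polynomial.aeval b f := by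
  rw [← Polynomial.eval_map_algebraMap, ← Polynomial.eval_map_algebraMap]
  exact h.trans (Polynomial.sub_dvd_eval_sub _ _ _)

theorem mul_dvd_aeval_sub_of_dvd_derivative {R : Type*} [CommRing R] (f : Polynomial ℤ)
    {a b d q : R} (hq : q ∣ a - b) (hd : d ∣ a - b)
    (hf : q ∣ Polynomial.aeval b (Polynomial.derivative f)) :
    d * q ∣ Polynomial.aeval a f - Polynomial.aeval b f := by
  obtain ⟨r, hr⟩ := Polynomial.binomExpansion (f.map (algebraMap ℤ R)) b (a - b)
  rw [add_sub_cancel, Polynomial.derivative_map, Polynomial.eval_map_algebraMap,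
    Polynomial.eval_map_algebraMap, Polynomial.eval_map_algebraMap] at hr
  have hsub : Polynomial.aeval a f - Polynomial.aeval b f =
      (a - b) * (Polynomial.aeval b (Polynomial.derivative f) + r * (a - b)) := by
    rw [hr]; ring
  rw [hsub]
  exact mul_dvd_mul hd (dvd_add hf (hq.mul_left r))

theorem castHom_polyMap {l m : ℕ} (h : l ∣ m) (f : Polynomial ℤ) (u : ZMod m) :
    ZMod.castHom h (ZMod l) (polyMap m f u) = polyMap l f (ZMod.castHom h (ZMod l) u) := by
  unfold polyMap
  exact (Polynomial.aeval_algHom_apply (ZMod.castHom h (ZMod l)).toIntAlgHom u f).symm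

theorem castHom_polyMap_iterate {l m : ℕ} (h : l ∣ m) (f : Polynomial ℤ) (i : ℕ) (u : ZMod m) :
    ZMod.castHom h (ZMod l) ((polyMap m f)^[i] u) =
      (polyMap l f)^[i] (ZMod.castHom h (ZMod l) u) :=
  Function.Semiconj.iterate_right (f := ZMod.castHom h (ZMod l)) (castHom_polyMap h f) i u

theorem natCast_dvd_of_castHom_eq_zero {l m : ℕ} (h : l ∣ m) (u : ZMod m)
    (hu : ZMod.castHom h (ZMod l) u = 0) : (l : ZMod m) ∣ u := by
  obtain ⟨z, rfl⟩ := ZMod.intCast_surjective u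
  rw [map_intCast, ZMod.intCast_zmod_eq_zero_iff_dvd] at hu
  obtain ⟨t, rfl⟩ := hu
  exact ⟨(t : ZMod m), by push_cast; ring⟩

theorem dvd_polyMap_iterate_sub {m : ℕ} (f : Polynomial ℤ) {a b d : ZMod m} (h : d ∣ a - b)
    (i : ℕ) : d ∣ (polyMap m f)^[i] a - (polyMap m f)^[i] b := by
  induction i with
  | zero => exact h
  | succ i ih =>
    rw [Function.iterate_succ_apply', Function.iterate_succ_apply']
    exact dvd_aeval_sub_of_dvd_sub f ih

/-- Over a periodic critical point `c` of `F_l`, each turn around the cycle gains one factor `l`. -/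
theorem pow_dvd_polyMap_iterate_sub {l m : ℕ} (h : l ∣ m) (f : Polynomial ℤ) {k : ℕ} (hk : 0 < k)
    {c : ZMod l} (hc : (polyMap l f)^[k] c = c)
    (hcrit : Polynomial.aeval c (Polynomial.derivative f) = 0) {a b : ZMod m}
    (ha : ZMod.castHom h (ZMod l) a = c) (hb : ZMod.castHom h (ZMod l) b = c) (j : ℕ) :
    (l : ZMod m) ^ j ∣ (polyMap m f)^[k * j] a - (polyMap m f)^[k * j] b := by
  induction j with
  | zero => simp
  | succ j ih =>
    obtain ⟨k, rfl⟩ : ∃ k', k = k' + 1 := ⟨k - 1, by omega⟩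
    have hcj : (polyMap l f)^[(k + 1) * j] c = c := by
      rw [Function.iterate_mul]; exact Function.iterate_fixed hc j
    have ha' := castHom_polyMap_iterate h f ((k + 1) * j) a
    have hb' := castHom_polyMap_iterate h f ((k + 1) * j) b
    rw [ha, hcj] at ha'
    rw [hb, hcj] at hb'
    have hstep : (k + 1) * (j + 1) = k + (1 + (k + 1) * j) := by ring
    rw [hstep, Function.iterate_add_apply, Function.iterate_add_apply _ k,
      Function.iterate_add_apply _ 1, Function.iterate_add_apply _ 1]
    refine dvd_polyMap_iterate_sub f ?_ k
    rw [pow_succ]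
    refine mul_dvd_aeval_sub_of_dvd_derivative f ?_ ih ?_
    · exact natCast_dvd_of_castHom_eq_zero h _ (by rw [map_sub, ha', hb', sub_self])
    · refine natCast_dvd_of_castHom_eq_zero h _ ?_
      rw [← hcrit, ← hb']
      exact (Polynomial.aeval_algHom_apply (ZMod.castHom h (ZMod l)).toIntAlgHom _ _).symm

theorem polyMap_iterate_eq_of_castHom_eq {p n : ℕ} (h : p ∣ p ^ n) (f : Polynomial ℤ) {k : ℕ}
    (hk : 0 < k) {c : ZMod p} (hc : (polyMap p f)^[k] c = c)
    (hcrit : Polynomial.aeval c (Polynomial.derivative f) = 0) {a b : ZMod (p ^ n)}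
    (ha : ZMod.castHom h (ZMod p) a = c) (hb : ZMod.castHom h (ZMod p) b = c) :
    (polyMap (p ^ n) f)^[k * n] a = (polyMap (p ^ n) f)^[k * n] b := by
  have hdvd := pow_dvd_polyMap_iterate_sub h f hk hc hcrit ha hb n
  rw [← Nat.cast_pow, ZMod.natCast_self, zero_dvd_iff] at hdvd
  exact sub_eq_zero.mp hdvd

/-- Let `v ∈ ZMod p` be a periodic point of `F_p` of minimal period `k`
with `λ̄(v) = 0`. Then for every `n ≥ 1`, the periodic points of `F_{p^n}` projecting into
the cycle of `v` form a single cycle of size `k`: there is a periodic point `w` of minimal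
period `k` such that the set of periodic points of `F_{p^n}` whose projection lies on the
cycle of `v` is exactly the orbit `{w, F_{p^n}(w), …, F_{p^n}^{k−1}(w)}`. -/
theorem lifts_multiplier_zero_unique_cycle (p : ℕ) (hp : p.Prime) (f : Polynomial ℤ)
    (k : ℕ) (v : ZMod p)
    (hv : v ∈ Function.periodicPts (polyMap p f))
    (hk : Function.minimalPeriod (polyMap p f) v = k)
    (hlam : multiplier p f k v = 0) :
    ∀ n : ℕ, ∀ hn : n ≠ 0,
      ∃ w : ZMod (p ^ n),
        Function.minimalPeriod (polyMap (p ^ n) f) w = k ∧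
        {u : ZMod (p ^ n) |
            (∃ i < k, (polyMap p f)^[i] v =
              ZMod.castHom (dvd_pow_self p hn) (ZMod p) u) ∧
            u ∈ Function.periodicPts (polyMap (p ^ n) f)} =
          {u : ZMod (p ^ n) | ∃ i < k, (polyMap (p ^ n) f)^[i] w = u} := by
  intro n hn
  have := Fact.mk hp
  set F := polyMap p f with hF
  set G := polyMap (p ^ n) f with hG
  set π := ZMod.castHom (dvd_pow_self p hn) (ZMod p) with hπ
  have hk0 : 0 < k := hk ▸ Function.minimalPeriod_pos_of_mem_periodicPts hv
  have hvk : F^[k] v = v := hk ▸ Function.iterate_minimalPeriod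
  have hFi : ∀ i, F^[k] (F^[i] v) = F^[i] v := fun i => by
    rw [← Function.iterate_add_apply, add_comm, Function.iterate_add_apply, hvk]
  obtain ⟨s, hs, hcrit⟩ := Finset.prod_eq_zero_iff.mp hlam
  rw [Finset.mem_range] at hs
  have hcmin : Function.minimalPeriod F (F^[s] v) = k := by
    rw [Function.minimalPeriod_apply_iterate hv, hk]
  have hpi : ∀ i u, π (G^[i] u) = F^[i] (π u) := castHom_polyMap_iterate (dvd_pow_self p hn) f
  have hcontr : ∀ {a b}, π a = F^[s] v → π b = F^[s] v → G^[k * n] a = G^[k * n] b :=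
    polyMap_iterate_eq_of_castHom_eq (dvd_pow_self p hn) f hk0 (hFi s) hcrit
  obtain ⟨u₀, hu₀⟩ := ZMod.castHom_surjective (dvd_pow_self p hn) (F^[s] v)
  have hck : ∀ j, F^[k * j] (F^[s] v) = F^[s] v := fun j => by
    rw [Function.iterate_mul]; exact Function.iterate_fixed (hFi s) j
  set w := G^[k * n] u₀ with hw
  have hπw : π w = F^[s] v := by rw [hw, hpi, hu₀, hck]
  have hwk : G^[k] w = w := by
    rw [hw, ← Function.iterate_add_apply, add_comm, Function.iterate_add_apply]
    exact hcontr (by rw [hpi, hu₀, hFi]) hu₀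
  have hwj : ∀ j, G^[k * j] w = w := fun j => by
    rw [Function.iterate_mul]; exact Function.iterate_fixed hwk j
  have hwmod : ∀ i, G^[i % k] w = G^[i] w := fun i => by
    conv_rhs => rw [← Nat.mod_add_div i k, Function.iterate_add_apply, hwj]
  refine ⟨w, ?_, ?_⟩
  · refine Nat.dvd_antisymm (Function.IsPeriodicPt.minimalPeriod_dvd hwk) ?_
    rw [← hcmin]
    refine Function.IsPeriodicPt.minimalPeriod_dvd ?_
    change F^[_] _ = _
    rw [← hπw, ← hpi, Function.iterate_minimalPeriod]
  · ext u
    simp only [Set.mem_ofPred_eq]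
    constructor
    · rintro ⟨⟨i, hi, hiu⟩, N, hN, hNu⟩
      have hNj : ∀ j, G^[N * j] u = u := fun j => by
        rw [Function.iterate_mul]; exact Function.iterate_fixed hNu j
      set t := s + (k - i) with ht
      have hπt : π (G^[t] u) = F^[s] v := by
        rw [hpi, ← hiu, ← Function.iterate_add_apply, show t + i = s + k by omega,
          Function.iterate_add_apply, hvk]
      have hreach : G^[k * n + t] u = w := by
        rw [Function.iterate_add_apply, hw]
        exact hcontr hπt hu₀
      set T := k * n + t with hT
      refine ⟨(N * T - T) % k, Nat.mod_lt _ hk0, ?_⟩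
      rw [hwmod, ← hreach, ← Function.iterate_add_apply,
        Nat.sub_add_cancel (Nat.le_mul_of_pos_left T hN), hNj]
    · rintro ⟨i, -, rfl⟩
      refine ⟨⟨(i + s) % k, Nat.mod_lt _ hk0, ?_⟩, k, hk0, ?_⟩
      · rw [hpi, hπw, ← Function.iterate_add_apply, ← hk, Function.iterate_mod_minimalPeriod_eq]
      · change G^[k] _ = _
        rw [← Function.iterate_add_apply, add_comm, Function.iterate_add_apply, hwk]
end
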